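/- arXiv:2207.05038 — 2 statements merged into one kernel-verified Lean document; each statement's English description precedes it below -/
import Mathlib

section
/- Let N, T ≥ 1 and let A(s) = Σ_{n ≤ N} a_n n^{−s} with complex coefficients. Then ∫_{−T}^{T} |A(it)|² dt ≪ T Σ_{n ≤ N} |a_n|² + T Σ_{0 < |k| ≤ N/T} Σ_{n ≤ N} |a_n| |a_{n+k}|, with an absolute implied constant (where a_m = 0 for m outside [1,N]). -/
open Finset MeasureTheory
open scoped FourierTransform SchwartzMap ContDiff

/-- A Schwartz bump supported in `(-1, 1)` with nonvanishing mean. -/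
lemma exists_schwartz_bump :
    ∃ g : 𝓢(ℝ, ℂ), (∀ x : ℝ, 1 ≤ |x| → g x = 0) ∧ 𝓕 g 0 ≠ 0 := by
  let φ : ContDiffBump (0 : ℝ) := ⟨1 / 2, 1, by norm_num, by norm_num⟩
  have hs : HasCompactSupport (fun x : ℝ => (φ x : ℂ)) :=
    φ.hasCompactSupport.comp_left (g := fun y : ℝ => (y : ℂ)) (by simp)
  have hc : ContDiff ℝ ∞ (fun x : ℝ => (φ x : ℂ)) :=
    Complex.ofRealCLM.contDiff.comp φ.contDiff
  refine ⟨hs.toSchwartzMap hc, fun x hx => ?_, ?_⟩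
  · have : φ x = 0 := φ.zero_of_le_dist (by simpa [Real.dist_eq] using hx)
    simp [this]
  · rw [SchwartzMap.fourier_coe, Real.fourier_real_eq]
    have h : 0 < ∫ x, φ x := φ.integral_pos
    simp only [mul_zero, neg_zero, AddChar.map_zero_eq_one, one_smul,
      HasCompactSupport.toSchwartzMap_toFun]
    change (∫ x, (φ x : ℂ)) ≠ 0
    rw [integral_complex_ofReal]
    exact_mod_cast h.ne'

lemma fourier_compSubConst (g : 𝓢(ℝ, ℂ)) (μ ξ : ℝ) :
    𝓕 (g.compSubConstCLM ℂ μ) ξ =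
      Complex.exp (-(2 * Real.pi * μ * ξ * Complex.I)) * 𝓕 g ξ := by
  simp only [SchwartzMap.fourier_coe, Real.fourier_real_eq_integral_exp_smul,
    SchwartzMap.compSubConstCLM_apply, smul_eq_mul]
  rw [← integral_const_mul,
    ← integral_sub_right_eq_self
      (fun v : ℝ => Complex.exp (-(2 * Real.pi * μ * ξ * Complex.I)) *
        (Complex.exp (↑(-2 * Real.pi * v * ξ) * Complex.I) * g v)) μ]
  congr 1
  ext v
  rw [← mul_assoc, ← Complex.exp_add]
  congr 2
  push_cast
  ring

lemma integrable_norm_mul_norm (f g : 𝓢(ℝ, ℂ)) :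
    Integrable fun x => ‖f x‖ * ‖g x‖ := by
  have := (f.memLp 2 volume).norm.integrable_mul (g.memLp 2 volume).norm
  exact this

/-- The correlation of two translates of a function supported in `(-1, 1)`. -/
lemma integral_norm_translate_mul_le (g : 𝓢(ℝ, ℂ)) (hg : ∀ x : ℝ, 1 ≤ |x| → g x = 0)
    (μ ν : ℝ) :
    ∫ x, ‖g (x - μ)‖ * ‖g (x - ν)‖ ≤ if |μ - ν| < 2 then ∫ x, ‖g x‖ ^ 2 else 0 := by
  have hi (μ ν : ℝ) : Integrable fun x => ‖g (x - μ)‖ * ‖g (x - ν)‖ :=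
    integrable_norm_mul_norm (g.compSubConstCLM ℂ μ) (g.compSubConstCLM ℂ ν)
  split_ifs with h
  · have hμ := integral_sub_right_eq_self (μ := volume) (fun x => ‖g x‖ * ‖g x‖) μ
    have hν := integral_sub_right_eq_self (μ := volume) (fun x => ‖g x‖ * ‖g x‖) ν
    calc _ ≤ ∫ x, (‖g (x - μ)‖ * ‖g (x - μ)‖ + ‖g (x - ν)‖ * ‖g (x - ν)‖) / 2 := by
          refine integral_mono (hi μ ν) (((hi μ μ).add (hi ν ν)).div_const 2) fun x => ?_
          dsimp only
          nlinarith [sq_nonneg (‖g (x - μ)‖ - ‖g (x - ν)‖)]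
      _ = _ := by
          rw [integral_div, integral_add (hi μ μ) (hi ν ν), hμ, hν]
          simp only [sq]
          ring
  · refine le_of_eq (integral_eq_zero_of_ae (Filter.Eventually.of_forall fun x => ?_))
    by_cases hx : 1 ≤ |x - μ|
    · simp [hg _ hx]
    · have : 1 ≤ |x - ν| := by
        have := abs_sub_le (x - ν) 0 (x - μ)
        rw [show x - ν - (x - μ) = μ - ν by ring, sub_zero, zero_sub, abs_neg] at this
        linarith
      simp [hg _ this]

/-- Plancherel bound for a combination of translates of a function supported in `(-1, 1)`. -/
lemma integral_norm_sq_translates_le (g : 𝓢(ℝ, ℂ)) (hg : ∀ x : ℝ, 1 ≤ |x| → g x = 0)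
    (s : Finset ℕ) (a : ℕ → ℂ) (μ : ℕ → ℝ) :
    ∫ ξ, ‖𝓕 (∑ i ∈ s, a i • g.compSubConstCLM ℂ (μ i)) ξ‖ ^ 2 ≤
      (∫ x, ‖g x‖ ^ 2) *
        ∑ i ∈ s, ∑ j ∈ s, if |μ i - μ j| < 2 then ‖a i‖ * ‖a j‖ else 0 := by
  rw [SchwartzMap.integral_norm_sq_fourier]
  have hi (i j : ℕ) : Integrable fun x =>
      ‖a i‖ * ‖a j‖ * (‖g (x - μ i)‖ * ‖g (x - μ j)‖) :=
    (integrable_norm_mul_norm (g.compSubConstCLM ℂ (μ i))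
      (g.compSubConstCLM ℂ (μ j))).const_mul _
  calc _ ≤ ∫ x, ∑ i ∈ s, ∑ j ∈ s, ‖a i‖ * ‖a j‖ * (‖g (x - μ i)‖ * ‖g (x - μ j)‖) := by
        refine integral_mono_of_nonneg (Filter.Eventually.of_forall fun x => by positivity)
          (integrable_finsetSum _ fun i _ => integrable_finsetSum _ fun j _ => hi i j)
          (Filter.Eventually.of_forall fun x => ?_)
        dsimp only
        calc _ ≤ (∑ i ∈ s, ‖a i‖ * ‖g (x - μ i)‖) ^ 2 := by
              gcongr
              rw [_root_.sum_apply]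
              refine (norm_sum_le _ _).trans (le_of_eq (Finset.sum_congr rfl fun i _ => ?_))
              simp
          _ = _ := by
              rw [sq, Finset.sum_mul_sum]
              exact Finset.sum_congr rfl fun i _ => Finset.sum_congr rfl fun j _ => by ring
    _ = ∑ i ∈ s, ∑ j ∈ s, ‖a i‖ * ‖a j‖ * ∫ x, ‖g (x - μ i)‖ * ‖g (x - μ j)‖ := by
        rw [integral_finsetSum _ fun i _ => integrable_finsetSum _ fun j _ => hi i j]
        refine Finset.sum_congr rfl fun i _ => ?_
        rw [integral_finsetSum _ fun j _ => hi i j]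
        exact Finset.sum_congr rfl fun j _ => integral_const_mul _ _
    _ ≤ _ := by
        rw [Finset.mul_sum]
        refine Finset.sum_le_sum fun i _ => ?_
        rw [Finset.mul_sum]
        refine Finset.sum_le_sum fun j _ => ?_
        refine (mul_le_mul_of_nonneg_left (integral_norm_translate_mul_le g hg (μ i) (μ j))
          (by positivity)).trans (le_of_eq ?_)
        split_ifs <;> ring

/-- Mean value bound for generalized Dirichlet polynomials: only pairs of frequencies at distance
less than `1 / T` contribute. -/
lemma exists_mean_value_bound :
    ∃ C : ℝ, 0 < C ∧ ∀ (s : Finset ℕ) (a : ℕ → ℂ) (l : ℕ → ℝ) (T : ℝ), 0 < T →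
      (∫ t in (-T)..T, ‖∑ i ∈ s, a i * Complex.exp (-(l i * t * Complex.I))‖ ^ 2) ≤
        C * (T * ∑ i ∈ s, ∑ j ∈ s, if T * |l i - l j| < 1 then ‖a i‖ * ‖a j‖ else 0) := by
  obtain ⟨g, hg, hg0⟩ := exists_schwartz_bump
  set M := ∫ x, ‖g x‖ ^ 2
  have hM : 0 ≤ M := integral_nonneg fun x => by positivity
  set c := ‖𝓕 g 0‖ / 2
  have hc : 0 < c := half_pos (norm_pos_iff.2 hg0)
  have hcont : Continuous fun ξ => ‖𝓕 g ξ‖ := (𝓕 g).continuous.norm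
  obtain ⟨δ, hδ, hball⟩ := Metric.eventually_nhds_iff.1
    (hcont.continuousAt.eventually_const_lt (half_lt_self (norm_pos_iff.2 hg0)))
  set r := min (δ / 2) (1 / (4 * Real.pi))
  have hr : 0 < r := lt_min (by positivity) (by positivity)
  have hrπ : 4 * Real.pi * r ≤ 1 := by
    have := min_le_right (δ / 2) (1 / (4 * Real.pi))
    rwa [le_div_iff₀ (by positivity), mul_comm] at this
  have hlow (ξ : ℝ) (hξ : |ξ| ≤ r) : c ≤ ‖𝓕 g ξ‖ := by
    refine (hball ?_).le
    rw [Real.dist_eq, sub_zero]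
    have := min_le_left (δ / 2) (1 / (4 * Real.pi))
    change r ≤ _ at this
    linarith
  refine ⟨(M + 1) / (r * c ^ 2), by positivity, fun s a l T hT => ?_⟩
  set μ : ℕ → ℝ := fun i => l i * (T / (2 * Real.pi * r)) with hμ
  set F : ℝ → ℂ := fun t => ∑ i ∈ s, a i * Complex.exp (-(l i * t * Complex.I)) with hF
  set f : 𝓢(ℝ, ℂ) := ∑ i ∈ s, a i • g.compSubConstCLM ℂ (μ i)
  have hfour (ξ : ℝ) : 𝓕 f ξ = F (T / r * ξ) * 𝓕 g ξ := by
    simp only [f, FourierTransform.fourier_sum, FourierTransform.fourier_smul,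
      _root_.sum_apply, _root_.smul_apply, fourier_compSubConst, hF, Finset.sum_mul,
      smul_eq_mul, ← mul_assoc]
    refine Finset.sum_congr rfl fun i _ => ?_
    congr 3
    have : (Real.pi : ℂ) ≠ 0 := by exact_mod_cast Real.pi_ne_zero
    have : (r : ℂ) ≠ 0 := by exact_mod_cast hr.ne'
    simp only [hμ]
    push_cast
    field_simp
  have hFc : Continuous F := by fun_prop
  have hfi : Integrable fun ξ => ‖𝓕 f ξ‖ ^ 2 := by
    simpa only [sq] using integrable_norm_mul_norm (𝓕 f) (𝓕 f)
  have hsub : ∫ t in (-T)..T, ‖F t‖ ^ 2 = T / r * ∫ ξ in (-r)..r, ‖F (T / r * ξ)‖ ^ 2 := by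
    rw [intervalIntegral.mul_integral_comp_mul_left (f := fun t => ‖F t‖ ^ 2)]
    congr 1 <;> field_simp
  have hmain : c ^ 2 * ∫ ξ in (-r)..r, ‖F (T / r * ξ)‖ ^ 2 ≤
      M * ∑ i ∈ s, ∑ j ∈ s, if |μ i - μ j| < 2 then ‖a i‖ * ‖a j‖ else 0 := by
    calc _ = ∫ ξ in (-r)..r, c ^ 2 * ‖F (T / r * ξ)‖ ^ 2 :=
          (intervalIntegral.integral_const_mul _ _).symm
      _ ≤ ∫ ξ in (-r)..r, ‖𝓕 f ξ‖ ^ 2 := by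
          refine intervalIntegral.integral_mono_on (by linarith)
            (Continuous.intervalIntegrable (by fun_prop) _ _) hfi.intervalIntegrable
            fun ξ hξ => ?_
          rw [hfour, norm_mul, mul_pow, mul_comm]
          gcongr
          exact hlow ξ (abs_le.2 hξ)
      _ ≤ ∫ ξ, ‖𝓕 f ξ‖ ^ 2 := by
          rw [intervalIntegral.integral_of_le (by linarith)]
          exact setIntegral_le_integral hfi (Filter.Eventually.of_forall fun x => by positivity)
      _ ≤ _ := integral_norm_sq_translates_le g hg s a μ
  have hcond (i j : ℕ) (h : |μ i - μ j| < 2) : T * |l i - l j| < 1 := by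
    have hpos : 0 < T / (2 * Real.pi * r) := by positivity
    rw [hμ, ← sub_mul, abs_mul, abs_of_pos hpos, mul_div_assoc', div_lt_iff₀ (by positivity)] at h
    linarith
  have hsum : (∑ i ∈ s, ∑ j ∈ s, if |μ i - μ j| < 2 then ‖a i‖ * ‖a j‖ else 0) ≤
      ∑ i ∈ s, ∑ j ∈ s, if T * |l i - l j| < 1 then ‖a i‖ * ‖a j‖ else 0 := by
    refine Finset.sum_le_sum fun i _ => Finset.sum_le_sum fun j _ => ?_
    by_cases h : |μ i - μ j| < 2
    · rw [if_pos h, if_pos (hcond i j h)]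
    · rw [if_neg h]
      split_ifs <;> positivity
  set S := ∑ i ∈ s, ∑ j ∈ s, if T * |l i - l j| < 1 then ‖a i‖ * ‖a j‖ else 0
  have hS : 0 ≤ S := Finset.sum_nonneg fun i _ => Finset.sum_nonneg fun j _ => by
    split_ifs <;> positivity
  have hI : ∫ ξ in (-r)..r, ‖F (T / r * ξ)‖ ^ 2 ≤ (M + 1) * S / c ^ 2 := by
    rw [le_div_iff₀ (by positivity), mul_comm]
    refine hmain.trans ((mul_le_mul_of_nonneg_left hsum hM).trans ?_)
    linarith
  calc _ = T / r * ∫ ξ in (-r)..r, ‖F (T / r * ξ)‖ ^ 2 := hsub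
    _ ≤ T / r * ((M + 1) * S / c ^ 2) := by gcongr
    _ = _ := by field_simp

/-- Integers in `[1, N]` whose logarithms are closer than `1 / T` differ by at most `N / T`. -/
lemma sub_le_floor_of_log_close {N m n : ℕ} {T : ℝ} (hT : 0 < T) (hn : 1 ≤ n) (hnm : n ≤ m)
    (hm : m ≤ N) (h : T * |Real.log n - Real.log m| < 1) : m - n ≤ ⌊(N : ℝ) / T⌋₊ := by
  have hn0 : (0 : ℝ) < n := by exact_mod_cast hn
  have hm0 : (0 : ℝ) < m := by exact_mod_cast hn.trans hnm
  have hlog : 1 - (n : ℝ) / m ≤ |Real.log n - Real.log m| := by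
    rw [← Real.log_div hn0.ne' hm0.ne']
    have := Real.log_le_sub_one_of_pos (div_pos hn0 hm0)
    have := neg_le_abs (Real.log (n / m))
    linarith
  apply Nat.le_floor
  rw [le_div_iff₀ hT, Nat.cast_sub hnm]
  have hmN : (m : ℝ) ≤ N := by exact_mod_cast hm
  have h1 : T * (1 - (n : ℝ) / m) ≤ 1 :=
    (mul_le_mul_of_nonneg_left hlog hT.le).trans h.le
  have h2 := mul_le_mul_of_nonneg_left h1 hm0.le
  have h3 : (m : ℝ) * (T * (1 - (n : ℝ) / m)) = (m - n) * T := by field_simp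
  linarith

lemma sum_close_log_le (N : ℕ) {T : ℝ} (hT : 0 < T) (b : ℕ → ℝ) (hb : ∀ n, 0 ≤ b n) :
    (∑ n ∈ Icc 1 N, ∑ m ∈ Icc 1 N,
        if T * |Real.log n - Real.log m| < 1 then b n * b m else 0) ≤
      ∑ n ∈ Icc 1 N, b n ^ 2 +
        2 * ∑ k ∈ Icc 1 ⌊(N : ℝ) / T⌋₊, ∑ n ∈ Icc 1 N, b n * b (n + k) := by
  set K := ⌊(N : ℝ) / T⌋₊
  have hbb (n m : ℕ) : 0 ≤ b n * b m := mul_nonneg (hb n) (hb m)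
  have hk (n m : ℕ) : 0 ≤ ∑ k ∈ Icc 1 K, if m = n + k then b n * b m else 0 :=
    Finset.sum_nonneg fun k _ => by split_ifs <;> simp [hbb]
  have hd (n m : ℕ) : 0 ≤ if n = m then b n * b m else 0 := by split_ifs <;> simp [hbb]
  have hlt {n m : ℕ} (hnm : n < m) (h : m - n ≤ K) :
      b n * b m ≤ ∑ k ∈ Icc 1 K, if m = n + k then b n * b m else 0 := by
    refine le_trans (le_of_eq ?_) (Finset.single_le_sum (a := m - n)
      (fun k _ => by split_ifs <;> simp [hbb]) (Finset.mem_Icc.2 ⟨by omega, h⟩))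
    rw [if_pos (by omega)]
  have hoff : (∑ n ∈ Icc 1 N, ∑ m ∈ Icc 1 N, ∑ k ∈ Icc 1 K,
      if m = n + k then b n * b m else 0) ≤
      ∑ k ∈ Icc 1 K, ∑ n ∈ Icc 1 N, b n * b (n + k) := by
    rw [Finset.sum_comm (s := Icc 1 K)]
    refine Finset.sum_le_sum fun n _ => ?_
    rw [Finset.sum_comm]
    refine Finset.sum_le_sum fun k _ => ?_
    rw [Finset.sum_ite_eq']
    split_ifs <;> simp [hbb]
  calc _ ≤ ∑ n ∈ Icc 1 N, ∑ m ∈ Icc 1 N, ((if n = m then b n * b m else 0) +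
        ((∑ k ∈ Icc 1 K, if m = n + k then b n * b m else 0) +
          ∑ k ∈ Icc 1 K, if n = m + k then b m * b n else 0)) := by
        refine Finset.sum_le_sum fun n hn => Finset.sum_le_sum fun m hm => ?_
        rw [Finset.mem_Icc] at hn hm
        have h1 := hd n m
        have h2 := hk n m
        have h3 := hk m n
        split_ifs with h h' h'
        · linarith
        · rcases lt_or_gt_of_ne h' with hnm | hnm
          · linarith [hlt hnm (sub_le_floor_of_log_close hT hn.1 hnm.le hm.2 h)]
          · rw [abs_sub_comm] at h
            linarith [hlt hnm (sub_le_floor_of_log_close hT hm.1 hnm.le hn.2 h),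
              mul_comm (b n) (b m)]
        · linarith [hbb n m]
        · linarith
    _ = ∑ n ∈ Icc 1 N, b n ^ 2 + ((∑ n ∈ Icc 1 N, ∑ m ∈ Icc 1 N, ∑ k ∈ Icc 1 K,
          if m = n + k then b n * b m else 0) + ∑ n ∈ Icc 1 N, ∑ m ∈ Icc 1 N, ∑ k ∈ Icc 1 K,
          if m = n + k then b n * b m else 0) := by
        simp only [Finset.sum_add_distrib]
        congr 1
        · refine Finset.sum_congr rfl fun n hn => ?_
          rw [Finset.sum_ite_eq, if_pos hn, sq]
        · congr 1
          exact Finset.sum_comm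
    _ ≤ _ := by linarith

/-- Improved mean value theorem for Dirichlet polynomials, useful for sparse coefficients:
`∫_{-T}^T |A(it)|² dt ≪ T ∑ |a_n|² + T ∑_{0<|k|≤N/T} ∑_n |a_n||a_{n+k}|`,
where `a_m = 0` for `m` outside `[1, N]` (so the off-diagonal sum over negative shifts
equals the one over positive shifts). -/
theorem stmt3 :
    ∃ C : ℝ, 0 < C ∧ ∀ (N : ℕ) (T : ℝ) (a : ℕ → ℂ), 1 ≤ N → 1 ≤ T →
      (∀ m : ℕ, (m = 0 ∨ N < m) → a m = 0) →
      (∫ t in (-T)..T,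
          ‖∑ n ∈ Finset.Icc 1 N, a n * (n : ℂ) ^ (-(Complex.I * (t : ℂ)))‖ ^ 2) ≤
        C * (T * ∑ n ∈ Finset.Icc 1 N, ‖a n‖ ^ 2 +
          T * 2 * ∑ k ∈ Finset.Icc 1 ⌊(N : ℝ) / T⌋₊,
            ∑ n ∈ Finset.Icc 1 N, ‖a n‖ * ‖a (n + k)‖) := by
  obtain ⟨C, hC, h⟩ := exists_mean_value_bound
  refine ⟨C, hC, fun N T a _ hT _ => ?_⟩
  have hT0 : 0 < T := by linarith
  have key := h (Icc 1 N) a (fun n => Real.log n) T hT0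
  have hterm (t : ℝ) : ∑ n ∈ Icc 1 N, a n * (n : ℂ) ^ (-(Complex.I * (t : ℂ))) =
      ∑ n ∈ Icc 1 N, a n * Complex.exp (-((Real.log n : ℝ) * t * Complex.I)) := by
    refine Finset.sum_congr rfl fun n hn => ?_
    have hn0 : (n : ℂ) ≠ 0 := by
      exact_mod_cast (Nat.one_le_iff_ne_zero.1 (Finset.mem_Icc.1 hn).1)
    rw [Complex.cpow_def_of_ne_zero hn0, ← Complex.natCast_log]
    congr 2
    ring
  simp only [hterm]
  refine key.trans (mul_le_mul_of_nonneg_left ?_ hC.le)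
  refine (mul_le_mul_of_nonneg_left
    (sum_close_log_le N hT0 (fun n => ‖a n‖) fun n => norm_nonneg _) hT0.le).trans
    (le_of_eq ?_)
  ring
end

section
/- Let T ≥ M ≥ 1, let 𝓜 ⊆ [M,T] be a set of integers with |𝓜| ≤ T^{1/3}, let N ≥ 2, and let M(s) = Σ_{m∈𝓜} ε_m m^{−s} with |ε_m| ≤ 1 and A(s) = Σ_{n∼N} a_n n^{−s} with real a_n. Then for any η > 0, ∫_{−T}^{T} |M(1+it)|² |A(1+it)|² dt ≪_η ((|𝓜|/M)² + (NT)^η |𝓜| T / (M² N)) · max_n |a_n|². -/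
open Finset MeasureTheory

/-- The divisor bound `d(n) ≪_ε n ^ ε`. -/
theorem exists_card_divisors_le_rpow (ε : ℝ) (hε : 0 < ε) :
    ∃ C : ℝ, 1 ≤ C ∧ ∀ n : ℕ, n ≠ 0 → (#n.divisors : ℝ) ≤ C * (n : ℝ) ^ ε := by
  set c : ℝ := 1 + 1 / (ε * Real.log 2) with hc
  have hl : 0 < Real.log 2 := Real.log_pos one_lt_two
  have hc1 : 1 ≤ c := by rw [hc]; simp only [le_add_iff_nonneg_right]; positivity
  set P : ℕ := ⌈(2 : ℝ) ^ (1 / ε)⌉₊ with hP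
  refine ⟨c ^ P, one_le_pow₀ hc1, fun n hn ↦ ?_⟩
  have key : ∀ p ∈ n.primeFactors, ((n.factorization p + 1 : ℕ) : ℝ) ≤
      (if p < P then c else 1) * ((p : ℝ) ^ n.factorization p) ^ ε := by
    intro p hp
    have hp2 : (2 : ℝ) ≤ p := by exact_mod_cast (Nat.prime_of_mem_primeFactors hp).two_le
    generalize n.factorization p = e
    split_ifs with h
    · have h1 : (2 : ℝ) ^ (ε * e) ≤ ((p : ℝ) ^ e) ^ ε := by
        rw [← Real.rpow_natCast_mul (by linarith), mul_comm]
        exact Real.rpow_le_rpow (by norm_num) hp2 (by positivity)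
      have h2 : 1 + ε * Real.log 2 * e ≤ (2 : ℝ) ^ (ε * e) := by
        rw [Real.rpow_def_of_pos two_pos]
        linarith [Real.add_one_le_exp (Real.log 2 * (ε * e))]
      calc ((e + 1 : ℕ) : ℝ) ≤ c * (1 + ε * Real.log 2 * e) := by
            rw [hc]; push_cast
            have : (1 + 1 / (ε * Real.log 2)) * (1 + ε * Real.log 2 * e)
              = 1 + ε * Real.log 2 * e + 1 / (ε * Real.log 2) + e := by field_simp; ring
            rw [this]
            have : 0 ≤ ε * Real.log 2 * e + 1 / (ε * Real.log 2) := by positivity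
            linarith
        _ ≤ _ := by gcongr; linarith
    · have h0 : (2 : ℝ) ^ (1 / ε) ≤ p := (Nat.le_ceil _).trans (by exact_mod_cast not_lt.mp h)
      have h1 : (2 : ℝ) ≤ (p : ℝ) ^ ε := by
        calc (2 : ℝ) = ((2 : ℝ) ^ (1 / ε)) ^ ε := by
              rw [← Real.rpow_mul (by norm_num), one_div_mul_cancel hε.ne', Real.rpow_one]
          _ ≤ _ := Real.rpow_le_rpow (by positivity) h0 hε.le
      rw [one_mul, ← Real.rpow_natCast_mul (by linarith), mul_comm, Real.rpow_mul_natCast (by linarith)]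
      calc ((e + 1 : ℕ) : ℝ) ≤ 2 ^ e := by exact_mod_cast Nat.lt_two_pow_self
        _ ≤ _ := by gcongr
  rw [Nat.card_divisors hn]
  push_cast
  have hprod : (n : ℝ) = ∏ p ∈ n.primeFactors, (p : ℝ) ^ n.factorization p := by
    conv_lhs => rw [← Nat.prod_factorization_pow_eq_self hn]
    rw [Finsupp.prod, Nat.support_factorization]; push_cast; rfl
  calc ∏ p ∈ n.primeFactors, ((n.factorization p : ℝ) + 1)
      ≤ ∏ p ∈ n.primeFactors, ((if p < P then c else 1) * ((p : ℝ) ^ n.factorization p) ^ ε) := by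
        refine prod_le_prod (fun _ _ ↦ by positivity) fun p hp ↦ ?_
        exact_mod_cast key p hp
    _ = (∏ p ∈ n.primeFactors, (if p < P then c else 1)) * (n : ℝ) ^ ε := by
        rw [prod_mul_distrib, hprod, Real.finsetProd_rpow _ _ fun _ _ ↦ by positivity]
    _ ≤ c ^ P * (n : ℝ) ^ ε := by
        gcongr
        rw [prod_ite, prod_const, prod_const_one, mul_one]
        refine pow_le_pow_right₀ hc1 ?_
        calc _ ≤ #(range P) := card_le_card fun p hp ↦ by simp_all
          _ = P := card_range P

theorem card_le_of_separated {ι : Type*} (s : Finset ι) (f : ι → ℝ) {a L d : ℝ} (hd : 0 < d)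
    (hL : 0 ≤ L) (hf : ∀ i ∈ s, a ≤ f i ∧ f i ≤ a + L)
    (hsep : ∀ i ∈ s, ∀ j ∈ s, i ≠ j → d ≤ |f i - f j|) : (#s : ℝ) ≤ 1 + L / d := by
  have h : #s ≤ #(range (⌊L / d⌋₊ + 1)) := by
    refine card_le_card_of_injOn (fun i ↦ ⌊(f i - a) / d⌋₊) ?_ ?_
    · intro i hi
      have := hf i hi
      simp only [coe_range, Set.mem_Iio, Nat.lt_add_one_iff]
      exact Nat.floor_le_floor (by gcongr; linarith)
    · intro i hi j hj hij
      by_contra hne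
      have h1 := hsep i hi j hj hne
      have hi0 : 0 ≤ (f i - a) / d := div_nonneg (by linarith [hf i hi]) hd.le
      have hj0 : 0 ≤ (f j - a) / d := div_nonneg (by linarith [hf j hj]) hd.le
      simp only at hij
      have h2 := Nat.floor_le hi0
      have h3 := Nat.floor_le hj0
      have h4 := Nat.lt_floor_add_one ((f i - a) / d)
      have h5 := Nat.lt_floor_add_one ((f j - a) / d)
      rw [hij] at h2 h4
      have h6 : |(f i - a) / d - (f j - a) / d| < 1 := by rw [abs_lt]; constructor <;> linarith
      rw [← sub_div, abs_div, abs_of_pos hd, div_lt_one hd] at h6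
      have : f i - a - (f j - a) = f i - f j := by ring
      rw [this] at h6
      linarith
  rw [card_range] at h
  calc (#s : ℝ) ≤ (⌊L / d⌋₊ + 1 : ℕ) := by exact_mod_cast h
    _ ≤ 1 + L / d := by
      push_cast; linarith [Nat.floor_le (show 0 ≤ L / d by positivity)]

/-- The number of pairs of indices whose `x`-values are within `δ` of each other. -/
noncomputable def closePairs {ι : Type*} (δ : ℝ) (s : Finset ι) (x : ι → ℝ) : ℝ :=
  ∑ i ∈ s, ∑ j ∈ s, if |x i - x j| ≤ δ then 1 else 0

theorem closePairs_nonneg {ι : Type*} (δ : ℝ) (s : Finset ι) (x : ι → ℝ) :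
    0 ≤ closePairs δ s x :=
  sum_nonneg fun _ _ ↦ sum_nonneg fun _ _ ↦ by split_ifs <;> norm_num

theorem sum_floor_sub_le_tsum_mul_closePairs {ι : Type*} (s : Finset ι) (x : ι → ℝ) {φ : ℤ → ℝ}
    (hφ : ∀ k, 0 ≤ φ k) (hsum : Summable φ) :
    ∑ i ∈ s, ∑ j ∈ s, φ (⌊x i⌋ - ⌊x j⌋) ≤ (∑' k, φ k) * closePairs 1 s x := by
  classical
  set b : ι → ℤ := fun i ↦ ⌊x i⌋
  set B := s.image b
  set n : ℤ → ℝ := fun k ↦ (#{i ∈ s | b i = k} : ℝ)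
  have hcomp : ∀ f : ℤ → ℝ, ∑ i ∈ s, f (b i) = ∑ k ∈ B, n k * f k := fun f ↦ by
    rw [sum_comp f b]; simp only [nsmul_eq_mul, n, B]
  have hrow : ∀ k, ∑ l ∈ B, φ (k - l) ≤ ∑' k, φ k := fun k ↦ by
    rw [← sum_image (f := φ) (g := fun l ↦ k - l) (fun _ _ _ _ h ↦ by simpa using h)]
    exact hsum.sum_le_tsum _ fun _ _ ↦ hφ _
  have hcol : ∀ l, ∑ k ∈ B, φ (k - l) ≤ ∑' k, φ k := fun l ↦ by
    rw [← sum_image (f := φ) (g := fun k ↦ k - l) (fun _ _ _ _ h ↦ by simpa using h)]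
    exact hsum.sum_le_tsum _ fun _ _ ↦ hφ _
  have hE : ∑ k ∈ B, n k ^ 2 ≤ closePairs 1 s x := by
    calc ∑ k ∈ B, n k ^ 2 = ∑ i ∈ s, n (b i) := by
          rw [hcomp]; exact sum_congr rfl fun _ _ ↦ sq _
      _ ≤ _ := sum_le_sum fun i _ ↦ by
          simp only [n]
          rw [card_filter]; push_cast
          refine sum_le_sum fun j _ ↦ ?_
          split_ifs with h1 h2
          · exact le_rfl
          · exact absurd (Int.abs_sub_lt_one_of_floor_eq_floor h1.symm).le h2
          all_goals norm_num
  calc ∑ i ∈ s, ∑ j ∈ s, φ (⌊x i⌋ - ⌊x j⌋)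
      = ∑ k ∈ B, ∑ l ∈ B, φ (k - l) * (n k * n l) := by
        change ∑ i ∈ s, ∑ j ∈ s, φ (b i - b j) = _
        rw [hcomp fun k ↦ ∑ j ∈ s, φ (k - b j)]
        refine sum_congr rfl fun k _ ↦ ?_
        rw [hcomp fun l ↦ φ (k - l), mul_sum]
        exact sum_congr rfl fun l _ ↦ by ring
    _ ≤ ∑ k ∈ B, ∑ l ∈ B, (φ (k - l) * (n k ^ 2 / 2) + φ (k - l) * (n l ^ 2 / 2)) := by
        gcongr with k _ l _
        rw [← mul_add]
        gcongr
        · exact hφ _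
        · linarith [two_mul_le_add_sq (n k) (n l)]
    _ = ∑ k ∈ B, (∑ l ∈ B, φ (k - l)) * (n k ^ 2 / 2) +
          ∑ l ∈ B, (∑ k ∈ B, φ (k - l)) * (n l ^ 2 / 2) := by
        simp only [sum_add_distrib, sum_mul]
        congr 1
        exact sum_comm
    _ ≤ ∑ k ∈ B, (∑' k, φ k) * (n k ^ 2 / 2) + ∑ l ∈ B, (∑' k, φ k) * (n l ^ 2 / 2) := by
        gcongr
        · exact hrow _
        · exact hcol _
    _ = (∑' k, φ k) * ∑ k ∈ B, n k ^ 2 := by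
        rw [← mul_sum, ← sum_div]; ring
    _ ≤ _ := by gcongr; exact tsum_nonneg hφ

theorem closePairs_smul {ι : Type*} (s : Finset ι) (x : ι → ℝ) {δ c : ℝ} (hc : 0 < c) :
    closePairs (c * δ) s (fun i ↦ c * x i) = closePairs δ s x := by
  unfold closePairs
  simp_rw [← mul_sub, abs_mul, abs_of_pos hc, mul_le_mul_iff_right₀ hc]

theorem exists_closePairs_two_mul_le :
    ∃ K : ℝ, 1 ≤ K ∧ ∀ {ι : Type} (s : Finset ι) (x : ι → ℝ) (δ : ℝ), 0 < δ →
      closePairs (2 * δ) s x ≤ K * closePairs δ s x := by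
  set φ : ℤ → ℝ := fun k ↦ if k ∈ Icc (-2 : ℤ) 2 then 1 else 0 with hφ
  have h0 : ∀ k, 0 ≤ φ k := fun k ↦ by simp only [hφ]; split_ifs <;> norm_num
  have hs : Summable φ := summable_of_ne_finset_zero (s := Icc (-2 : ℤ) 2) fun b hb ↦ by
    simp only [hφ, if_neg hb]
  refine ⟨max 1 (∑' k, φ k), le_max_left _ _, fun s x δ hδ ↦ ?_⟩
  have hδ' : 0 < δ⁻¹ := by positivity
  have e1 := closePairs_smul s x (δ := δ) hδ'
  have e2 := closePairs_smul s x (δ := 2 * δ) hδ'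
  rw [show δ⁻¹ * δ = 1 by field_simp] at e1
  rw [show δ⁻¹ * (2 * δ) = 2 by field_simp] at e2
  rw [← e1, ← e2]
  generalize (fun i ↦ δ⁻¹ * x i) = y
  refine le_trans ?_ ((sum_floor_sub_le_tsum_mul_closePairs s y h0 hs).trans
    (mul_le_mul_of_nonneg_right (le_max_right _ _) (closePairs_nonneg _ _ _)))
  refine sum_le_sum fun i _ ↦ sum_le_sum fun j _ ↦ ?_
  split_ifs with h
  · have : ⌊y i⌋ - ⌊y j⌋ ∈ Icc (-2 : ℤ) 2 := by
      rw [abs_le] at h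
      have h1 := Int.floor_le (y i)
      have h2 := Int.floor_le (y j)
      have h3 := Int.lt_floor_add_one (y i)
      have h4 := Int.lt_floor_add_one (y j)
      rw [mem_Icc]
      constructor
      · have : (-3 : ℝ) < ((⌊y i⌋ - ⌊y j⌋ : ℤ) : ℝ) := by push_cast; linarith
        have : (-3 : ℤ) < ⌊y i⌋ - ⌊y j⌋ := by exact_mod_cast this
        omega
      · have : ((⌊y i⌋ - ⌊y j⌋ : ℤ) : ℝ) < 3 := by push_cast; linarith
        have : ⌊y i⌋ - ⌊y j⌋ < (3 : ℤ) := by exact_mod_cast this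
        omega
    simp only [hφ, if_pos this, le_refl]
  · exact h0 _

theorem summable_exp_neg_int_sq_div {c : ℝ} (hc : 0 < c) :
    Summable fun k : ℤ ↦ Real.exp (-((k : ℝ) ^ 2 / c)) := by
  refine Summable.of_norm_bounded_eventually
    (g := fun k : ℤ ↦ c * (1 / (k : ℝ) ^ 2)) ?_ ?_
  · exact ((Real.summable_one_div_int_pow (p := 2)).2 one_lt_two).mul_left c
  · filter_upwards [(Set.finite_singleton (0 : ℤ)).compl_mem_cofinite] with k hk
    have hk0 : (k : ℝ) ≠ 0 := by simpa using hk
    have hpos : 0 < (k : ℝ) ^ 2 := by positivity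
    rw [Real.norm_eq_abs, abs_of_pos (Real.exp_pos _), Real.exp_neg]
    calc (Real.exp ((k : ℝ) ^ 2 / c))⁻¹ ≤ ((k : ℝ) ^ 2 / c)⁻¹ := by
          gcongr
          linarith [Real.add_one_le_exp ((k : ℝ) ^ 2 / c)]
      _ = c * (1 / (k : ℝ) ^ 2) := by field_simp

theorem integral_norm_sq_mul_gaussian_le {ι : Type*} (s : Finset ι) (x : ι → ℝ) (c : ι → ℂ)
    {b : ℝ} (hb : 0 < b) :
    Integrable (fun t : ℝ ↦ ‖∑ i ∈ s, c i * Complex.exp (-Complex.I * t * x i)‖ ^ 2 *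
      Real.exp (-b * t ^ 2)) ∧
    ∫ t : ℝ, ‖∑ i ∈ s, c i * Complex.exp (-Complex.I * t * x i)‖ ^ 2 * Real.exp (-b * t ^ 2) ≤
      ∑ i ∈ s, ∑ j ∈ s, ‖c i‖ * ‖c j‖ *
        (√(Real.pi / b) * Real.exp (-(x i - x j) ^ 2 / (4 * b))) := by
  set F : ι → ι → ℝ → ℂ := fun i j t ↦ c i * (starRingEnd ℂ) (c j) *
    (Complex.exp (Complex.I * ((x j - x i : ℝ) : ℂ) * t) * Complex.exp (-(b : ℂ) * t ^ 2))
  have hbre : 0 < (b : ℂ).re := by simpa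
  have hexp : ∀ t : ℝ, ((‖∑ i ∈ s, c i * Complex.exp (-Complex.I * t * x i)‖ ^ 2 *
      Real.exp (-b * t ^ 2) : ℝ) : ℂ) = ∑ i ∈ s, ∑ j ∈ s, F i j t := by
    intro t
    push_cast
    rw [← Complex.mul_conj', map_sum, sum_mul_sum, sum_mul]
    refine sum_congr rfl fun i _ ↦ ?_
    rw [sum_mul]
    refine sum_congr rfl fun j _ ↦ ?_
    simp only [F, map_mul, ← Complex.exp_conj, map_neg, Complex.conj_I, Complex.conj_ofReal]
    have : Complex.exp (Complex.I * ((x j - x i : ℝ) : ℂ) * t) =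
        Complex.exp (-Complex.I * t * x i) * Complex.exp (- -Complex.I * t * x j) := by
      rw [← Complex.exp_add]; congr 1; push_cast; ring
    rw [this]; ring
  have hint : ∀ i j, Integrable (F i j) := by
    intro i j
    refine Integrable.const_mul ?_ _
    have := integrable_cexp_quadratic (b := (b : ℂ)) hbre
      (Complex.I * ((x j - x i : ℝ) : ℂ)) 0
    refine this.congr (Filter.Eventually.of_forall fun t ↦ ?_)
    simp only
    rw [← Complex.exp_add]; congr 1; ring
  have hintS : Integrable (fun t ↦ ∑ i ∈ s, ∑ j ∈ s, F i j t) :=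
    integrable_finsetSum _ fun i _ ↦ integrable_finsetSum _ fun j _ ↦ hint i j
  have hI : Integrable (fun t : ℝ ↦ ‖∑ i ∈ s, c i * Complex.exp (-Complex.I * t * x i)‖ ^ 2 *
      Real.exp (-b * t ^ 2)) := by
    refine hintS.re.congr (Filter.Eventually.of_forall fun t ↦ ?_)
    simp only [← hexp t]
    exact Complex.ofReal_re _
  refine ⟨hI, ?_⟩
  calc _ ≤ ‖((∫ t : ℝ, ‖∑ i ∈ s, c i * Complex.exp (-Complex.I * t * x i)‖ ^ 2 *
        Real.exp (-b * t ^ 2) : ℝ) : ℂ)‖ := by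
        rw [Complex.norm_real]; exact le_abs_self _
    _ = ‖∑ i ∈ s, ∑ j ∈ s, ∫ t : ℝ, F i j t‖ := by
        rw [← integral_complex_ofReal]
        simp_rw [hexp]
        rw [integral_finsetSum _ fun i _ ↦ integrable_finsetSum _ fun j _ ↦ hint i j]
        simp_rw [integral_finsetSum s fun j _ ↦ hint _ j]
    _ ≤ ∑ i ∈ s, ∑ j ∈ s, ‖∫ t : ℝ, F i j t‖ :=
        (norm_sum_le _ _).trans (sum_le_sum fun i _ ↦ norm_sum_le _ _)
    _ = _ := by
        refine sum_congr rfl fun i _ ↦ sum_congr rfl fun j _ ↦ ?_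
        simp only [F]
        rw [integral_const_mul, fourierIntegral_gaussian hbre, norm_mul, norm_mul, norm_mul,
          Complex.norm_conj, Real.sqrt_eq_rpow]
        have h1 : ‖((Real.pi : ℂ) / b) ^ (1 / 2 : ℂ)‖ = (Real.pi / b) ^ (1 / 2 : ℝ) := by
          rw [← Complex.ofReal_div, Complex.norm_cpow_eq_rpow_re_of_pos (by positivity)]
          norm_num
        have h2 : ‖Complex.exp (-((x j - x i : ℝ) : ℂ) ^ 2 / (4 * b))‖ =
            Real.exp (-(x i - x j) ^ 2 / (4 * b)) := by
          rw [Complex.norm_exp]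
          congr 1
          have : (-((x j - x i : ℝ) : ℂ) ^ 2 / (4 * b)) =
            ((-(x i - x j) ^ 2 / (4 * b) : ℝ) : ℂ) := by push_cast; ring
          rw [this, Complex.ofReal_re]
        rw [h1, h2]

theorem exists_integral_norm_sq_le_closePairs :
    ∃ C : ℝ, 0 < C ∧ ∀ {ι : Type} (s : Finset ι) (x : ι → ℝ) (c : ι → ℂ) (T β : ℝ), 0 < T →
      (∀ i ∈ s, ‖c i‖ ≤ β) →
      ∫ t in (-T)..T, ‖∑ i ∈ s, c i * Complex.exp (-Complex.I * t * x i)‖ ^ 2 ≤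
        C * T * β ^ 2 * closePairs (1 / T) s x := by
  set φ : ℤ → ℝ := fun k ↦ Real.exp 1 * Real.exp (-((k : ℝ) ^ 2 / 8)) with hφ
  have h0 : ∀ k, 0 < φ k := fun k ↦ by positivity
  have hs : Summable φ := (summable_exp_neg_int_sq_div (by norm_num)).mul_left _
  have hS : 0 < ∑' k, φ k := hs.tsum_pos (fun k ↦ (h0 k).le) 0 (h0 0)
  refine ⟨Real.exp 1 * √Real.pi * ∑' k, φ k, by positivity, fun s x c T β hT hc ↦ ?_⟩
  set f : ℝ → ℝ := fun t ↦ ‖∑ i ∈ s, c i * Complex.exp (-Complex.I * t * x i)‖ ^ 2 with hf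
  have hfc : Continuous f := by fun_prop
  obtain ⟨hI, hle⟩ := integral_norm_sq_mul_gaussian_le s x c (b := 1 / T ^ 2) (by positivity)
  have hker : ∀ i j, Real.exp (-(x i - x j) ^ 2 / (4 * (1 / T ^ 2))) ≤
      φ (⌊T * x i⌋ - ⌊T * x j⌋) := by
    intro i j
    simp only [hφ]
    rw [← Real.exp_add, Real.exp_le_exp]
    have e : -(x i - x j) ^ 2 / (4 * (1 / T ^ 2)) = -(T * x i - T * x j) ^ 2 / 4 := by field_simp
    rw [e]
    have h1 := Int.fract_nonneg (T * x i)
    have h2 := Int.fract_lt_one (T * x i)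
    have h3 := Int.fract_nonneg (T * x j)
    have h4 := Int.fract_lt_one (T * x j)
    have h5 := Int.floor_add_fract (T * x i)
    have h6 := Int.floor_add_fract (T * x j)
    rw [← h5, ← h6]
    simp only [Int.floor_intCast_add]
    simp only [Int.floor_fract, add_zero]
    push_cast
    generalize (⌊T * x i⌋ : ℝ) = u at *
    generalize (⌊T * x j⌋ : ℝ) = v at *
    generalize Int.fract (T * x i) = p at *
    generalize Int.fract (T * x j) = q at *
    have h7 : (p - q) ^ 2 ≤ 1 := by
      rw [sq_le_one_iff_abs_le_one, abs_le]; constructor <;> linarith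
    nlinarith [sq_nonneg (u - v + 2 * (p - q))]
  calc ∫ t in (-T)..T, f t
      ≤ ∫ t in (-T)..T, Real.exp 1 * (f t * Real.exp (-(1 / T ^ 2) * t ^ 2)) := by
        refine intervalIntegral.integral_mono_on (by linarith) (hfc.intervalIntegrable _ _)
          (by apply Continuous.intervalIntegrable; fun_prop) fun t ht ↦ ?_
        have h1 : 1 ≤ Real.exp 1 * Real.exp (-(1 / T ^ 2) * t ^ 2) := by
          rw [← Real.exp_add]
          apply Real.one_le_exp
          have : t ^ 2 ≤ T ^ 2 := sq_le_sq' ht.1 ht.2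
          have : 1 / T ^ 2 * t ^ 2 ≤ 1 := by
            rw [one_div_mul_eq_div, div_le_one (by positivity)]; exact this
          linarith
        nlinarith [show 0 ≤ f t by positivity]
    _ = Real.exp 1 * ∫ t in (-T)..T, f t * Real.exp (-(1 / T ^ 2) * t ^ 2) := by
        rw [intervalIntegral.integral_const_mul]
    _ ≤ Real.exp 1 * ∫ t, f t * Real.exp (-(1 / T ^ 2) * t ^ 2) := by
        gcongr
        rw [intervalIntegral.integral_of_le (by linarith)]
        exact setIntegral_le_integral hI (Filter.Eventually.of_forall fun t ↦ by positivity)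
    _ ≤ Real.exp 1 * ∑ i ∈ s, ∑ j ∈ s, β * β *
          (√Real.pi * T * φ (⌊T * x i⌋ - ⌊T * x j⌋)) := by
        refine mul_le_mul_of_nonneg_left (hle.trans ?_) (Real.exp_pos _).le
        have e : √(Real.pi / (1 / T ^ 2)) = √Real.pi * T := by
          rw [div_div_eq_mul_div, div_one, Real.sqrt_mul Real.pi_pos.le, Real.sqrt_sq hT.le]
        rw [e]
        refine sum_le_sum fun i hi ↦ sum_le_sum fun j hj ↦ ?_
        have hβ : 0 ≤ β := (norm_nonneg _).trans (hc i hi)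
        gcongr
        · exact hc i hi
        · exact hc j hj
        · exact hker i j
    _ = Real.exp 1 * √Real.pi * T * β ^ 2 * ∑ i ∈ s, ∑ j ∈ s, φ (⌊T * x i⌋ - ⌊T * x j⌋) := by
        simp only [mul_sum]
        exact sum_congr rfl fun i _ ↦ sum_congr rfl fun j _ ↦ by ring
    _ ≤ Real.exp 1 * √Real.pi * T * β ^ 2 * ((∑' k, φ k) * closePairs 1 s fun i ↦ T * x i) := by
        gcongr
        exact sum_floor_sub_le_tsum_mul_closePairs s (fun i ↦ T * x i) (fun k ↦ (h0 k).le) hs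
    _ = _ := by
        rw [← closePairs_smul s x (δ := 1 / T) hT, mul_one_div_cancel hT.ne']; ring

theorem one_div_eq_add_sum_Icc {w N : ℕ} (hw : 1 ≤ w) (h : w ≤ N) :
    (1 : ℝ) / w = 1 / (N + 1) + ∑ k ∈ Icc w N, 1 / ((k : ℝ) * (k + 1)) := by
  induction N, h using Nat.le_induction with
  | base =>
    have : (w : ℝ) ≠ 0 := by positivity
    rw [Icc_self, sum_singleton]; field_simp
  | succ N hN ih =>
    rw [← insert_Icc_right_eq_Icc_add_one (by omega), sum_insert (by simp), ih]
    push_cast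
    field_simp
    ring

theorem sum_Icc_one_div_succ_le (N : ℕ) :
    ∑ k ∈ Icc 1 N, (1 : ℝ) / (k + 1) ≤ 1 + Real.log N := by
  refine le_trans ?_ (harmonic_le_one_add_log N)
  rw [harmonic_eq_sum_Icc]
  push_cast
  refine sum_le_sum fun k hk ↦ ?_
  have : (1 : ℝ) ≤ k := by exact_mod_cast (mem_Icc.1 hk).1
  rw [one_div]
  gcongr
  linarith

/-- The pairs of coprime positive integers up to `k`. -/
def coprimePairs (k : ℕ) : Finset (ℕ × ℕ) :=
  {p ∈ Icc 1 k ×ˢ Icc 1 k | p.1.Coprime p.2}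

theorem mem_coprimePairs {k : ℕ} {p : ℕ × ℕ} :
    p ∈ coprimePairs k ↔ ((1 ≤ p.1 ∧ p.1 ≤ k) ∧ (1 ≤ p.2 ∧ p.2 ≤ k)) ∧ p.1.Coprime p.2 := by
  simp [coprimePairs]

theorem sum_le_sum_coprimePairs_div_max {W : ℕ → ℕ → ℝ} (hW : ∀ a b, 0 ≤ W a b)
    (hom : ∀ h a b, 1 ≤ h → 1 ≤ a → 1 ≤ b → W (h * a) (h * b) = W a b) (N : ℕ) :
    ∑ p ∈ Icc 1 N ×ˢ Icc 1 N, W p.1 p.2 ≤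
      ∑ p ∈ coprimePairs N, W p.1 p.2 * (N * (1 / (max p.1 p.2 : ℕ))) := by
  have hmaps : ∀ p ∈ Icc 1 N ×ˢ Icc 1 N,
      (p.1 / p.1.gcd p.2, p.2 / p.1.gcd p.2) ∈ coprimePairs N := by
    rintro ⟨a, b⟩ hp
    simp only [mem_product, mem_Icc] at hp
    have hg : 0 < a.gcd b := Nat.gcd_pos_of_pos_left _ (by omega)
    rw [mem_coprimePairs]
    exact ⟨⟨⟨Nat.div_pos (Nat.gcd_le_left _ (by omega)) hg, (Nat.div_le_self _ _).trans hp.1.2⟩,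
      ⟨Nat.div_pos (Nat.gcd_le_right _ (by omega)) hg, (Nat.div_le_self _ _).trans hp.2.2⟩⟩,
      Nat.coprime_div_gcd_div_gcd hg⟩
  rw [← sum_fiberwise_of_maps_to hmaps]
  refine sum_le_sum fun q hq ↦ ?_
  obtain ⟨⟨⟨hq1, -⟩, ⟨hq2, -⟩⟩, -⟩ := mem_coprimePairs.1 hq
  have hfib : ∀ p ∈ Icc 1 N ×ˢ Icc 1 N, (p.1 / p.1.gcd p.2, p.2 / p.1.gcd p.2) = q →
      1 ≤ p.1.gcd p.2 ∧ p.1 = p.1.gcd p.2 * q.1 ∧ p.2 = p.1.gcd p.2 * q.2 := by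
    rintro ⟨a, b⟩ hp rfl
    simp only [mem_product, mem_Icc] at hp
    exact ⟨Nat.gcd_pos_of_pos_left _ (by omega), (Nat.mul_div_cancel' (Nat.gcd_dvd_left a b)).symm,
      (Nat.mul_div_cancel' (Nat.gcd_dvd_right a b)).symm⟩
  rw [sum_congr rfl (g := fun _ ↦ W q.1 q.2)]
  · rw [sum_const, nsmul_eq_mul, mul_comm]
    refine mul_le_mul_of_nonneg_left ?_ (hW _ _)
    rw [mul_one_div]
    refine le_trans ?_ Nat.cast_div_le
    rw [Nat.cast_le]
    refine le_trans ?_ (b := #(Icc 1 (N / max q.1 q.2))) (by simp)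
    refine card_le_card_of_injOn (fun p ↦ p.1.gcd p.2) ?_ ?_
    · intro p hp
      simp only [coe_filter, Set.mem_ofPred_eq] at hp
      obtain ⟨h1, h2, h3⟩ := hfib p hp.1 hp.2
      have hp1 := hp.1
      simp only [mem_product, mem_Icc] at hp1
      simp only [coe_Icc, Set.mem_Icc]
      refine ⟨h1, (Nat.le_div_iff_mul_le (by omega)).2 ?_⟩
      rcases max_choice q.1 q.2 with h | h <;> rw [h] <;> omega
    · intro p hp p' hp' h
      simp only [coe_filter, Set.mem_ofPred_eq] at hp hp'
      obtain ⟨-, h2, h3⟩ := hfib p hp.1 hp.2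
      obtain ⟨-, h2', h3'⟩ := hfib p' hp'.1 hp'.2
      simp only at h
      rw [h] at h2 h3
      exact Prod.ext (h2.trans h2'.symm) (h3.trans h3'.symm)
  · intro p hp
    rw [mem_filter] at hp
    obtain ⟨h1, h2, h3⟩ := hfib p hp.1 hp.2
    refine (congrArg₂ W h2 h3).trans ?_
    exact hom _ _ _ h1 hq1 hq2

theorem sum_le_of_sum_coprimePairs_le {W : ℕ → ℕ → ℝ} (hW : ∀ a b, 0 ≤ W a b)
    (hom : ∀ h a b, 1 ≤ h → 1 ≤ a → 1 ≤ b → W (h * a) (h * b) = W a b) {A B : ℝ}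
    (hA : 0 ≤ A) (hB : 0 ≤ B) {N : ℕ} (hN : 1 ≤ N)
    (hQ : ∀ k : ℕ, 1 ≤ k → ∑ p ∈ coprimePairs k, W p.1 p.2 ≤ A * k + B * k ^ 2) :
    ∑ p ∈ Icc 1 N ×ˢ Icc 1 N, W p.1 p.2 ≤ N * A * (2 + Real.log N) + 2 * B * N ^ 2 := by
  have hN' : (1 : ℝ) ≤ N := by exact_mod_cast hN
  have hstep : ∑ p ∈ coprimePairs N, W p.1 p.2 * (1 / (max p.1 p.2 : ℕ)) =
      (∑ p ∈ coprimePairs N, W p.1 p.2) * (1 / (N + 1)) +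
        ∑ k ∈ Icc 1 N, (∑ p ∈ coprimePairs k, W p.1 p.2) * (1 / ((k : ℝ) * (k + 1))) := by
    simp_rw [sum_mul]
    rw [sum_sigma' (Icc 1 N), sum_congr rfl (g := fun p ↦ W p.1 p.2 * (1 / ((N : ℝ) + 1)) +
      ∑ k ∈ Icc (max p.1 p.2) N, W p.1 p.2 * (1 / ((k : ℝ) * (k + 1)))), sum_add_distrib,
      sum_sigma' (coprimePairs N)]
    · congr 1
      refine sum_bij' (fun z _ ↦ ⟨z.2, z.1⟩) (fun z _ ↦ ⟨z.2, z.1⟩) ?_ ?_ ?_ ?_ ?_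
      · rintro ⟨p, k⟩ h
        simp only [mem_sigma, mem_coprimePairs, mem_Icc, max_le_iff] at h ⊢
        exact ⟨⟨by omega, by omega⟩, by omega, h.1.2⟩
      · rintro ⟨k, p⟩ h
        simp only [mem_sigma, mem_coprimePairs, mem_Icc, max_le_iff] at h ⊢
        exact ⟨⟨by omega, h.2.2⟩, by omega⟩
      all_goals intros; rfl
    · intro p hp
      have := mem_coprimePairs.1 hp
      rw [one_div_eq_add_sum_Icc (w := max p.1 p.2) (N := N) (by omega) (by omega), mul_add, mul_sum]
  calc _ ≤ _ := sum_le_sum_coprimePairs_div_max hW hom N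
    _ = N * ∑ p ∈ coprimePairs N, W p.1 p.2 * (1 / (max p.1 p.2 : ℕ)) := by
        rw [mul_sum]; exact sum_congr rfl fun _ _ ↦ by ring
    _ ≤ N * ((A * N + B * N ^ 2) * (1 / (N + 1)) +
          ∑ k ∈ Icc 1 N, (A * k + B * k ^ 2) * (1 / ((k : ℝ) * (k + 1)))) := by
        rw [hstep]
        gcongr with k hk
        · exact hQ N hN
        · exact hQ k (mem_Icc.1 hk).1
    _ ≤ N * ((A + B * N) + ∑ k ∈ Icc 1 N, (A * (1 / ((k : ℝ) + 1)) + B)) := by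
        gcongr with k hk
        · rw [mul_one_div, div_le_iff₀ (by positivity)]; nlinarith [mul_nonneg hB (by positivity : (0:ℝ) ≤ N)]
        · have hk1 : (1 : ℝ) ≤ k := by exact_mod_cast (mem_Icc.1 hk).1
          have : (A * k + B * k ^ 2) * (1 / ((k : ℝ) * (k + 1))) =
            A * (1 / ((k : ℝ) + 1)) + B * (k / (k + 1)) := by field_simp
          rw [this]
          have : (k : ℝ) / (k + 1) ≤ 1 := by rw [div_le_one (by positivity)]; linarith
          nlinarith
    _ ≤ N * ((A + B * N) + (A * (1 + Real.log N) + B * N)) := by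
        rw [sum_add_distrib, ← mul_sum, sum_const, Nat.card_Icc, nsmul_eq_mul, Nat.add_sub_cancel,
          mul_comm B]
        gcongr
        exact sum_Icc_one_div_succ_le N
    _ = _ := by ring

theorem one_div_le_abs_log_sub_log {a b : ℕ} {K : ℝ} (ha : 1 ≤ a) (hb : 1 ≤ b) (haK : a ≤ K)
    (hbK : b ≤ K) (hab : a ≠ b) : 1 / K ≤ |Real.log a - Real.log b| := by
  wlog h : b < a generalizing a b
  · rw [abs_sub_comm]; exact this hb ha hbK haK hab.symm (by omega)
  have ha' : (0 : ℝ) < a := by positivity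
  have hb' : (0 : ℝ) < b := by positivity
  have h1 : (b : ℝ) + 1 ≤ a := by exact_mod_cast h
  calc 1 / K ≤ 1 / a := by gcongr
    _ ≤ 1 - ((a : ℝ) / b)⁻¹ := by
        rw [inv_div, le_sub_iff_add_le, ← add_div, div_le_one ha']; linarith
    _ ≤ Real.log (a / b) := Real.one_sub_inv_le_log_of_pos (by positivity)
    _ = Real.log a - Real.log b := Real.log_div ha'.ne' hb'.ne'
    _ ≤ _ := le_abs_self _

theorem card_coprimePairs_log_close_le {T : ℝ} (hT : 0 < T) (θ : ℝ) {k : ℕ} (hk : 1 ≤ k) :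
    (#{p ∈ coprimePairs k | |Real.log p.1 - Real.log p.2 - θ| ≤ 1 / T} : ℝ) ≤
      1 + 2 * k ^ 2 / T := by
  have := card_le_of_separated {p ∈ coprimePairs k | |Real.log p.1 - Real.log p.2 - θ| ≤ 1 / T}
    (fun p ↦ Real.log p.1 - Real.log p.2) (a := θ - 1 / T) (L := 2 / T) (d := 1 / (k : ℝ) ^ 2)
    (by positivity) (by positivity) ?_ ?_
  · refine this.trans_eq ?_
    field_simp
  · intro p hp
    have := abs_le.1 (mem_filter.1 hp).2
    have e : 2 / T = 1 / T + 1 / T := by ring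
    constructor <;> linarith
  · rintro ⟨a, b⟩ hp ⟨c, d⟩ hq hne
    obtain ⟨⟨⟨ha, ha'⟩, ⟨hb, hb'⟩⟩, hab⟩ := mem_coprimePairs.1 (mem_filter.1 hp).1
    obtain ⟨⟨⟨hc, hc'⟩, ⟨hd, hd'⟩⟩, hcd⟩ := mem_coprimePairs.1 (mem_filter.1 hq).1
    simp only at *
    have hmul : a * d ≠ c * b := by
      intro h
      have h1 : a = c := Nat.dvd_antisymm (hab.dvd_of_dvd_mul_right ⟨d, h.symm⟩)
        (hcd.dvd_of_dvd_mul_right ⟨b, h⟩)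
      subst h1
      exact hne (by rw [Nat.eq_of_mul_eq_mul_left (by omega) h])
    have := one_div_le_abs_log_sub_log (a := a * d) (b := c * b) (K := (k : ℝ) ^ 2)
      (Nat.mul_pos ha hd) (Nat.mul_pos hc hb) (by exact_mod_cast sq k ▸ Nat.mul_le_mul ha' hd')
      (by exact_mod_cast sq k ▸ Nat.mul_le_mul hc' hb') hmul
    rw [Nat.cast_mul, Nat.cast_mul, Real.log_mul (by positivity) (by positivity),
      Real.log_mul (by positivity) (by positivity)] at this
    refine this.trans_eq (congrArg _ (by ring))

theorem sum_Icc_mul_le {N : ℕ} {D : ℝ} (hD : ∀ k ∈ Icc 1 (N ^ 2), (#k.divisors : ℝ) ≤ D)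
    {g : ℕ → ℝ} (hg : ∀ k, 0 ≤ g k) :
    ∑ a ∈ Icc 1 N, ∑ b ∈ Icc 1 N, g (a * b) ≤ D * ∑ k ∈ Icc 1 (N ^ 2), g k := by
  have hmaps : ∀ p ∈ Icc 1 N ×ˢ Icc 1 N, p.1 * p.2 ∈ Icc 1 (N ^ 2) := by
    rintro ⟨a, b⟩ hp
    simp only [mem_product, mem_Icc] at hp ⊢
    exact ⟨Nat.mul_pos hp.1.1 hp.2.1, sq N ▸ Nat.mul_le_mul hp.1.2 hp.2.2⟩
  rw [← sum_product' (Icc 1 N) (Icc 1 N) fun a b ↦ g (a * b), ← sum_fiberwise_of_maps_to hmaps,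
    mul_sum]
  refine sum_le_sum fun k hk ↦ ?_
  rw [sum_congr rfl (g := fun _ ↦ g k) fun p hp ↦ by rw [(mem_filter.1 hp).2], sum_const,
    nsmul_eq_mul]
  refine mul_le_mul_of_nonneg_right (le_trans ?_ (hD k hk)) (hg k)
  rw [Nat.cast_le]
  refine card_le_card_of_injOn Prod.fst ?_ ?_
  · intro p hp
    have := mem_filter.1 hp
    exact Nat.mem_divisors.2 ⟨⟨p.2, this.2.symm⟩, by have := (mem_Icc.1 hk).1; omega⟩
  · rintro ⟨a, b⟩ hp ⟨c, d⟩ hq (h : a = c)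
    have h1 := mem_filter.1 hp
    have h2 := mem_filter.1 hq
    simp only [mem_product, mem_Icc] at h1 h2
    subst h
    rw [Nat.eq_of_mul_eq_mul_left (by omega) (h1.2.trans h2.2.symm)]

theorem card_log_close_le {T : ℝ} (hT : 0 < T) {s : Finset ℕ} (hs : ∀ m ∈ s, 1 ≤ m ∧ (m : ℝ) ≤ T)
    (θ : ℝ) : (#{m ∈ s | |Real.log (m : ℕ) - θ| ≤ 1 / T} : ℝ) ≤ 3 := by
  have := card_le_of_separated {m ∈ s | |Real.log (m : ℕ) - θ| ≤ 1 / T}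
    (fun m ↦ Real.log m) (a := θ - 1 / T) (L := 2 / T) (d := 1 / T)
    (by positivity) (by positivity) ?_ ?_
  · refine this.trans_eq ?_
    field_simp
    norm_num
  · intro p hp
    have := abs_le.1 (mem_filter.1 hp).2
    have e : 2 / T = 1 / T + 1 / T := by ring
    constructor <;> linarith
  · intro a ha b hb hne
    have ha' := hs a (mem_filter.1 ha).1
    have hb' := hs b (mem_filter.1 hb).1
    exact one_div_le_abs_log_sub_log ha'.1 hb'.1 ha'.2 hb'.2 hne

/-- `log (m n)` for a pair `(m, n)` of positive integers. -/
noncomputable def logMul (p : ℕ × ℕ) : ℝ := Real.log p.1 + Real.log p.2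

theorem sum_logMul_mul_le {N : ℕ} {D : ℝ} (hD0 : 0 ≤ D)
    (hD : ∀ k ∈ Icc 1 (N ^ 2), (#k.divisors : ℝ) ≤ D) (s : Finset ℕ) (δ : ℝ) :
    ∑ q ∈ s ×ˢ (Icc 1 N ×ˢ Icc 1 N), ∑ q' ∈ s ×ˢ (Icc 1 N ×ˢ Icc 1 N),
      (if |logMul (q.1, q.2.1 * q'.2.2) - logMul (q'.1, q'.2.1 * q.2.2)| ≤ δ then (1 : ℝ) else 0) ≤
      D ^ 2 * closePairs δ (s ×ˢ Icc 1 (N ^ 2)) logMul := by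
  set G : ℕ → ℕ → ℕ → ℕ → ℝ := fun m k m' k' ↦
    if |logMul (m, k) - logMul (m', k')| ≤ δ then (1 : ℝ) else 0
  have hG : ∀ m k m' k', 0 ≤ G m k m' k' := fun _ _ _ _ ↦ by
    simp only [G]; split_ifs <;> norm_num
  have hswap : ∀ H : ℕ → ℕ → ℕ → ℕ → ℝ,
      ∑ a ∈ Icc 1 N, ∑ b ∈ Icc 1 N, ∑ c ∈ Icc 1 N, ∑ d ∈ Icc 1 N, H a b c d =
      ∑ a ∈ Icc 1 N, ∑ d ∈ Icc 1 N, ∑ c ∈ Icc 1 N, ∑ b ∈ Icc 1 N, H a b c d := fun H ↦ by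
    refine sum_congr rfl fun a _ ↦ ?_
    rw [sum_comm, sum_comm (s := Icc 1 N) (t := Icc 1 N) (f := fun d c ↦ ∑ b ∈ Icc 1 N, H a b c d)]
    exact sum_congr rfl fun c _ ↦ sum_comm
  have hinner : ∀ m m', ∑ a ∈ Icc 1 N, ∑ b ∈ Icc 1 N, ∑ c ∈ Icc 1 N, ∑ d ∈ Icc 1 N,
      G m (a * d) m' (c * b) ≤ D ^ 2 * ∑ k ∈ Icc 1 (N ^ 2), ∑ k' ∈ Icc 1 (N ^ 2), G m k m' k' := by
    intro m m'
    rw [hswap fun a b c d ↦ G m (a * d) m' (c * b), sq, mul_assoc]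
    refine (sum_Icc_mul_le hD (g := fun k ↦ ∑ c ∈ Icc 1 N, ∑ b ∈ Icc 1 N, G m k m' (c * b))
      fun k ↦ sum_nonneg fun _ _ ↦ sum_nonneg fun _ _ ↦ hG _ _ _ _).trans ?_
    refine mul_le_mul_of_nonneg_left ?_ hD0
    rw [mul_sum]
    exact sum_le_sum fun k _ ↦ sum_Icc_mul_le hD fun k' ↦ hG _ _ _ _
  calc _ = ∑ m ∈ s, ∑ m' ∈ s, ∑ a ∈ Icc 1 N, ∑ b ∈ Icc 1 N, ∑ c ∈ Icc 1 N, ∑ d ∈ Icc 1 N,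
      G m (a * d) m' (c * b) := by
        simp only [sum_product]
        refine sum_congr rfl fun m _ ↦ ?_
        rw [sum_congr rfl fun a _ ↦ sum_comm, sum_comm]
    _ ≤ ∑ m ∈ s, ∑ m' ∈ s, D ^ 2 * ∑ k ∈ Icc 1 (N ^ 2), ∑ k' ∈ Icc 1 (N ^ 2), G m k m' k' :=
        sum_le_sum fun m _ ↦ sum_le_sum fun m' _ ↦ hinner m m'
    _ = _ := by
        simp only [closePairs, sum_product, mul_sum]
        refine sum_congr rfl fun m _ ↦ ?_
        rw [sum_comm]

theorem sq_closePairs_le {T : ℝ} (hT : 0 < T) {s : Finset ℕ} (hs : ∀ m ∈ s, 1 ≤ m ∧ (m : ℝ) ≤ T)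
    {N : ℕ} {D : ℝ} (hD0 : 0 ≤ D) (hD : ∀ k ∈ Icc 1 (N ^ 2), (#k.divisors : ℝ) ≤ D) :
    closePairs (1 / T) (s ×ˢ Icc 1 N) logMul ^ 2 ≤
      #s * (3 * D ^ 2 * closePairs (2 * (1 / T)) (s ×ˢ Icc 1 (N ^ 2)) logMul) := by
  set Q := s ×ˢ (Icc 1 N ×ˢ Icc 1 N)
  set u : ℕ → ℕ × ℕ × ℕ → ℝ := fun m q ↦
    if |logMul (m, q.2.2) - logMul (q.1, q.2.1)| ≤ 1 / T then 1 else 0 with hu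
  have hu0 : ∀ m q, 0 ≤ u m q := fun m q ↦ by simp only [hu]; split_ifs <;> norm_num
  set v : ℕ × ℕ × ℕ → ℕ × ℕ × ℕ → ℝ := fun q q' ↦
    if |logMul (q.1, q.2.1 * q'.2.2) - logMul (q'.1, q'.2.1 * q.2.2)| ≤ 2 * (1 / T)
    then 1 else 0 with hv
  have hv0 : ∀ q q', 0 ≤ v q q' := fun m q ↦ by simp only [hv]; split_ifs <;> norm_num
  have hS : closePairs (1 / T) (s ×ˢ Icc 1 N) logMul = ∑ m ∈ s, ∑ q ∈ Q, u m q := by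
    simp only [closePairs, Q, sum_product]
    refine sum_congr rfl fun m _ ↦ ?_
    rw [sum_comm]
    exact sum_congr rfl fun m' _ ↦ sum_comm
  have huv : ∀ m, ∀ q ∈ Q, ∀ q' ∈ Q, u m q * u m q' ≤ u m q * v q q' := by
    intro m q hq q' hq'
    by_cases h : |logMul (m, q.2.2) - logMul (q.1, q.2.1)| ≤ 1 / T
    swap
    · rw [show u m q = 0 by simp only [hu, if_neg h], zero_mul, zero_mul]
    by_cases h' : |logMul (m, q'.2.2) - logMul (q'.1, q'.2.1)| ≤ 1 / T
    swap
    · rw [show u m q' = 0 by simp only [hu, if_neg h'], mul_zero]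
      exact mul_nonneg (hu0 _ _) (hv0 _ _)
    have : v q q' = 1 := by
      simp only [hv]
      rw [if_pos]
      simp only [Q, mem_product, mem_Icc] at hq hq'
      simp only [logMul, Nat.cast_mul] at h h' ⊢
      rw [Real.log_mul (Nat.cast_ne_zero.2 (by omega)) (Nat.cast_ne_zero.2 (by omega)),
        Real.log_mul (Nat.cast_ne_zero.2 (by omega)) (Nat.cast_ne_zero.2 (by omega))]
      rw [abs_le] at h h' ⊢
      constructor <;> linarith
    rw [this]
    refine mul_le_mul_of_nonneg_left ?_ (hu0 _ _)
    simp only [hu, if_pos h', le_refl]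
  have hu3 : ∀ q, ∑ m ∈ s, u m q ≤ 3 := by
    intro q
    have := card_log_close_le hT hs (logMul (q.1, q.2.1) - Real.log q.2.2)
    rw [card_filter] at this
    push_cast at this
    refine (sum_le_sum fun m _ ↦ ?_).trans this
    simp only [hu]
    rw [show logMul (m, q.2.2) - logMul (q.1, q.2.1) =
      Real.log m - (logMul (q.1, q.2.1) - Real.log q.2.2) by simp only [logMul]; ring]
  calc _ = (∑ m ∈ s, ∑ q ∈ Q, u m q) ^ 2 := by rw [hS]
    _ ≤ #s * ∑ m ∈ s, (∑ q ∈ Q, u m q) ^ 2 := sq_sum_le_card_mul_sum_sq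
    _ ≤ #s * ∑ m ∈ s, ∑ q ∈ Q, ∑ q' ∈ Q, u m q * v q q' := by
        gcongr with m _
        rw [sq, sum_mul_sum]
        exact sum_le_sum fun q hq ↦ sum_le_sum fun q' hq' ↦ huv m q hq q' hq'
    _ = #s * ∑ q ∈ Q, ∑ q' ∈ Q, (∑ m ∈ s, u m q) * v q q' := by
        rw [sum_comm]
        congr 1
        refine sum_congr rfl fun q _ ↦ ?_
        rw [sum_comm]
        simp only [sum_mul]
    _ ≤ #s * ∑ q ∈ Q, ∑ q' ∈ Q, 3 * v q q' := by
        refine mul_le_mul_of_nonneg_left (sum_le_sum fun q _ ↦ sum_le_sum fun q' _ ↦ ?_)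
          (Nat.cast_nonneg _)
        exact mul_le_mul_of_nonneg_right (hu3 q) (hv0 _ _)
    _ = #s * (3 * ∑ q ∈ Q, ∑ q' ∈ Q, v q q') := by simp only [mul_sum]
    _ ≤ _ := by
        rw [mul_assoc 3]
        gcongr
        exact sum_logMul_mul_le hD0 hD s _

theorem closePairs_le_of_forall_le {T : ℝ} (hT : 0 < T) {s : Finset ℕ} {X : ℝ} (hX : 0 ≤ X)
    (h : ∀ k ∈ Icc 1 #s, closePairs (1 / T) (s ×ˢ Icc 1 k) logMul ≤ X * (k * #s)) {N : ℕ}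
    (hN : 1 ≤ N) :
    closePairs (1 / T) (s ×ˢ Icc 1 N) logMul ≤
      N * ((X + 1) * #s) * (2 + Real.log N) + 2 * (2 * #s ^ 2 / T) * N ^ 2 := by
  set W : ℕ → ℕ → ℝ := fun a b ↦
    ∑ m ∈ s, ∑ m' ∈ s, if |logMul (m, a) - logMul (m', b)| ≤ 1 / T then 1 else 0 with hWdef
  have hW : ∀ a b, 0 ≤ W a b := fun a b ↦
    sum_nonneg fun _ _ ↦ sum_nonneg fun _ _ ↦ by split_ifs <;> norm_num
  have hS : ∀ k, closePairs (1 / T) (s ×ˢ Icc 1 k) logMul =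
      ∑ p ∈ Icc 1 k ×ˢ Icc 1 k, W p.1 p.2 := by
    intro k
    simp only [closePairs, hWdef, sum_product]
    rw [sum_comm]
    refine sum_congr rfl fun a _ ↦ ?_
    rw [sum_congr rfl fun m _ ↦ sum_comm, sum_comm]
  rw [hS]
  refine sum_le_of_sum_coprimePairs_le hW ?_ (by positivity) (by positivity) hN ?_
  · intro h a b hh ha hb
    simp only [hWdef, logMul, Nat.cast_mul]
    rw [Real.log_mul (by positivity) (by positivity), Real.log_mul (by positivity) (by positivity)]
    refine sum_congr rfl fun m _ ↦ sum_congr rfl fun m' _ ↦ ?_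
    congr 3
    ring
  · intro k hk
    rcases le_or_gt k #s with hks | hks
    · calc _ ≤ ∑ p ∈ Icc 1 k ×ˢ Icc 1 k, W p.1 p.2 :=
            sum_le_sum_of_subset_of_nonneg (filter_subset _ _) fun _ _ _ ↦ hW _ _
        _ = _ := (hS k).symm
        _ ≤ _ := h k (mem_Icc.2 ⟨hk, hks⟩)
        _ ≤ (X + 1) * #s * k := by
            have : (0 : ℝ) ≤ #s * k := by positivity
            linarith
        _ ≤ _ := le_add_of_nonneg_right (by positivity)
    · calc _ = ∑ m ∈ s, ∑ m' ∈ s, ∑ p ∈ coprimePairs k,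
              (if |logMul (m, p.1) - logMul (m', p.2)| ≤ 1 / T then (1 : ℝ) else 0) := by
            simp only [hWdef]
            rw [sum_comm]
            exact sum_congr rfl fun m _ ↦ sum_comm
        _ ≤ ∑ m ∈ s, ∑ m' ∈ s, (1 + 2 * (k : ℝ) ^ 2 / T) := by
            refine sum_le_sum fun m _ ↦ sum_le_sum fun m' _ ↦ ?_
            have := card_coprimePairs_log_close_le hT (Real.log m' - Real.log m) hk
            rw [card_filter] at this
            push_cast at this
            refine (sum_le_sum fun p _ ↦ ?_).trans this
            rw [show logMul (m, p.1) - logMul (m', p.2) =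
              Real.log p.1 - Real.log p.2 - (Real.log m' - Real.log m) by
                simp only [logMul]; ring]
        _ = (#s : ℝ) * #s + 2 * #s ^ 2 / T * k ^ 2 := by
            simp only [sum_const, nsmul_eq_mul]; ring
        _ ≤ _ := by
            have h1 : (#s : ℝ) ≤ k := by exact_mod_cast hks.le
            have h2 : (0 : ℝ) ≤ X * #s * k := by positivity
            have h3 : (#s : ℝ) * #s ≤ #s * k := by gcongr
            linarith

theorem closePairs_mono {ι : Type*} (δ : ℝ) {s t : Finset ι} (h : s ⊆ t) (x : ι → ℝ) :
    closePairs δ s x ≤ closePairs δ t x := by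
  have h0 : ∀ i j, (0 : ℝ) ≤ if |x i - x j| ≤ δ then 1 else 0 := fun i j ↦ by
    split_ifs <;> norm_num
  refine (sum_le_sum fun i _ ↦ sum_le_sum_of_subset_of_nonneg h fun j _ _ ↦ h0 i j).trans ?_
  exact sum_le_sum_of_subset_of_nonneg h fun i _ _ ↦ sum_nonneg fun j _ ↦ h0 i j

theorem closePairs_le_of_doubling {K D T : ℝ} (hT : 1 ≤ T) (hK : 1 ≤ K) (hD1 : 1 ≤ D)
    (hdouble : ∀ {ι : Type} (s : Finset ι) (x : ι → ℝ) (δ : ℝ), 0 < δ →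
      closePairs (2 * δ) s x ≤ K * closePairs δ s x)
    (hD : ∀ k : ℕ, k ≠ 0 → (k : ℝ) ≤ T → (#k.divisors : ℝ) ≤ D)
    {s : Finset ℕ} (hs : ∀ m ∈ s, 1 ≤ m ∧ (m : ℝ) ≤ T) (hcard : (#s : ℝ) ^ 3 ≤ T) :
    ∀ k ∈ Icc 1 #s, closePairs (1 / T) (s ×ˢ Icc 1 k) logMul ≤
      (2 * (3 * K * D ^ 2 * (6 + Real.log T))) * (k * #s) := by
  have hT0 : 0 < T := by linarith
  set L := 3 * K * D ^ 2 * (6 + Real.log T) with hL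
  have hlogT := Real.log_nonneg hT
  have hKD : 1 ≤ K * D ^ 2 := one_le_mul_of_one_le_of_one_le hK (one_le_pow₀ hD1)
  have hL1 : 1 ≤ L := by rw [hL]; nlinarith
  intro k hk
  have hR : 1 ≤ #s := (mem_Icc.1 hk).1.trans (mem_Icc.1 hk).2
  have hR' : (1 : ℝ) ≤ #s := by exact_mod_cast hR
  obtain ⟨V, hV, hmax⟩ := exists_max_image (Icc 1 #s)
    (fun k ↦ closePairs (1 / T) (s ×ˢ Icc 1 k) logMul / (k * #s)) ⟨k, hk⟩
  obtain ⟨hV1, hVR⟩ := mem_Icc.1 hV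
  have hV1' : (1 : ℝ) ≤ V := by exact_mod_cast hV1
  have hVR' : (V : ℝ) ≤ #s := by exact_mod_cast hVR
  set X := closePairs (1 / T) (s ×ˢ Icc 1 V) logMul / (V * #s) with hX
  have hX0 : 0 ≤ X := div_nonneg (closePairs_nonneg _ _ _) (by positivity)
  have hXbound : ∀ k ∈ Icc 1 #s,
      closePairs (1 / T) (s ×ˢ Icc 1 k) logMul ≤ X * (k * #s) := fun k hk ↦ by
    have hk1 : (1 : ℝ) ≤ k := by exact_mod_cast (mem_Icc.1 hk).1
    exact (div_le_iff₀ (by positivity)).1 (hmax k hk)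
  have hRV : (#s : ℝ) * V ^ 2 ≤ T := by
    calc (#s : ℝ) * V ^ 2 ≤ #s * (#s : ℝ) ^ 2 := by gcongr
      _ = (#s : ℝ) ^ 3 := by ring
      _ ≤ T := hcard
  have hV2T : (V : ℝ) ^ 2 ≤ T := by nlinarith [sq_nonneg (V : ℝ)]
  have hsq := sq_closePairs_le hT0 hs (N := V) (D := D) (by linarith) fun k hk ↦
    hD k (by have := (mem_Icc.1 hk).1; omega)
      (le_trans (by exact_mod_cast (mem_Icc.1 hk).2) hV2T)
  have hV2 := closePairs_le_of_forall_le hT0 hX0 hXbound (N := V ^ 2) (Nat.one_le_pow _ _ hV1)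
  have hlog : Real.log ((V ^ 2 : ℕ) : ℝ) ≤ Real.log T := by
    push_cast
    exact Real.log_le_log (by positivity) hV2T
  have hS : closePairs (1 / T) (s ×ˢ Icc 1 (V ^ 2)) logMul ≤
      V ^ 2 * #s * ((X + 1) * (6 + Real.log T)) := by
    have h1 : 2 * (2 * (#s : ℝ) ^ 2 / T) * ((V ^ 2 : ℕ) : ℝ) ^ 2 ≤ 4 * ((V : ℝ) ^ 2 * #s) := by
      calc 2 * (2 * (#s : ℝ) ^ 2 / T) * ((V ^ 2 : ℕ) : ℝ) ^ 2
          = 4 * ((V : ℝ) ^ 2 * #s) * ((#s * V ^ 2) / T) := by push_cast; ring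
        _ ≤ 4 * ((V : ℝ) ^ 2 * #s) * 1 := by
            gcongr
            rwa [div_le_one hT0]
        _ = _ := mul_one _
    have h2 : ((V ^ 2 : ℕ) : ℝ) * ((X + 1) * #s) * (2 + Real.log ((V ^ 2 : ℕ) : ℝ)) ≤
        V ^ 2 * #s * ((X + 1) * (2 + Real.log T)) := by
      calc _ ≤ ((V ^ 2 : ℕ) : ℝ) * ((X + 1) * #s) * (2 + Real.log T) := by gcongr
        _ = _ := by push_cast; ring
    have h3 : 0 ≤ (V : ℝ) ^ 2 * #s * X := by positivity
    linarith
  have hXL : X ^ 2 ≤ L * (X + 1) := by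
    have hXe : closePairs (1 / T) (s ×ˢ Icc 1 V) logMul = X * (V * #s) := by
      rw [hX, div_mul_cancel₀ _ (by positivity)]
    have hpos : 0 < ((V : ℝ) * #s) ^ 2 := pow_pos (mul_pos (by linarith) (by linarith)) 2
    refine le_of_mul_le_mul_right ?_ hpos
    calc X ^ 2 * ((V : ℝ) * #s) ^ 2 = closePairs (1 / T) (s ×ˢ Icc 1 V) logMul ^ 2 := by
          rw [hXe]; ring
      _ ≤ _ := hsq
      _ ≤ #s * (3 * D ^ 2 * (K * (V ^ 2 * #s * ((X + 1) * (6 + Real.log T))))) := by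
          refine mul_le_mul_of_nonneg_left (mul_le_mul_of_nonneg_left ?_ ?_) (Nat.cast_nonneg _)
          · exact (hdouble _ _ _ (by positivity)).trans
              (mul_le_mul_of_nonneg_left hS (by linarith))
          · positivity
      _ = _ := by rw [hL]; ring
  have hX2L : X ≤ 2 * L := by
    by_contra! h
    nlinarith
  exact (hXbound k hk).trans (by gcongr)

/-- The number of `m, μ ∈ s` and `n, ν ≤ N` with `|log (m n / (μ ν))| ≤ 1 / T` is
`≪_η N |s| (NT) ^ η + |s|² N² / T` when `|s| ≤ T ^ (1/3)`. -/
theorem exists_closePairs_logMul_le (η : ℝ) (hη : 0 < η) :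
    ∃ C : ℝ, 0 < C ∧ ∀ (T : ℝ) (N : ℕ) (s : Finset ℕ), 1 ≤ T → 1 ≤ N →
      (∀ m ∈ s, 1 ≤ m ∧ (m : ℝ) ≤ T) → (#s : ℝ) ^ 3 ≤ T →
      closePairs (1 / T) (s ×ˢ Icc 1 N) logMul ≤
        C * (N * #s * (N * T) ^ η + #s ^ 2 * N ^ 2 / T) := by
  obtain ⟨K, hK, hdouble⟩ := exists_closePairs_two_mul_le
  set ε := η / 4 with hε
  have hε0 : 0 < ε := by positivity
  obtain ⟨c, hc, hdiv⟩ := exists_card_divisors_le_rpow ε hε0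
  refine ⟨9 * K * c ^ 2 * (6 + 1 / ε) ^ 2 + 4, by positivity, fun T N s hT hN hs hcard ↦ ?_⟩
  have hT0 : 0 < T := by linarith
  have hN' : (1 : ℝ) ≤ N := by exact_mod_cast hN
  set D := c * T ^ ε
  have hTε : 1 ≤ T ^ ε := Real.one_le_rpow hT hε0.le
  have hD1 : 1 ≤ D := one_le_mul_of_one_le_of_one_le hc hTε
  have hlogT := Real.log_nonneg hT
  have hlogN := Real.log_nonneg hN'
  set L := 3 * K * D ^ 2 * (6 + Real.log T) with hL
  have hKD : 1 ≤ K * D ^ 2 := one_le_mul_of_one_le_of_one_le hK (one_le_pow₀ hD1)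
  have hL1 : 1 ≤ L := by rw [hL]; nlinarith
  have hmain := closePairs_le_of_forall_le hT0 (X := 2 * L) (by linarith)
    (closePairs_le_of_doubling hT hK hD1 hdouble
      (fun k hk hkT ↦ (hdiv k hk).trans (by simp only [D]; gcongr)) hs hcard) hN
  set Y := (N : ℝ) * T
  have hTY : T ≤ Y := le_mul_of_one_le_left hT0.le hN'
  have hNY : (N : ℝ) ≤ Y := le_mul_of_one_le_right (by linarith) hT
  have hY1 : 1 ≤ Y := hT.trans hTY
  have hYε : 1 ≤ Y ^ ε := Real.one_le_rpow hY1 hε0.le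
  have hlogY : 6 + Real.log Y ≤ (6 + 1 / ε) * Y ^ ε := by
    have := Real.log_le_rpow_div (by linarith : 0 ≤ Y) hε0
    rw [add_mul, one_div_mul_eq_div]
    linarith
  have h1 : 6 + Real.log T ≤ (6 + 1 / ε) * Y ^ ε :=
    le_trans (by gcongr) hlogY
  have h2 : 2 + Real.log N ≤ (6 + 1 / ε) * Y ^ ε :=
    le_trans (by gcongr; norm_num) hlogY
  have hfac : (2 * L + 1) * (2 + Real.log N) ≤ 9 * K * c ^ 2 * (6 + 1 / ε) ^ 2 * Y ^ η := by
    calc (2 * L + 1) * (2 + Real.log N)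
        ≤ (3 * (3 * K * (c * Y ^ ε) ^ 2 * ((6 + 1 / ε) * Y ^ ε))) * ((6 + 1 / ε) * Y ^ ε) := by
          gcongr
          calc 2 * L + 1 ≤ 3 * L := by linarith
            _ ≤ _ := by
              rw [hL]
              simp only [D]
              gcongr
      _ = 9 * K * c ^ 2 * (6 + 1 / ε) ^ 2 * (Y ^ ε) ^ 4 := by ring
      _ = _ := by
          rw [← Real.rpow_mul_natCast (by linarith), hε]
          norm_num
  refine hmain.trans ?_
  calc N * ((2 * L + 1) * #s) * (2 + Real.log N) + 2 * (2 * #s ^ 2 / T) * N ^ 2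
      = N * #s * ((2 * L + 1) * (2 + Real.log N)) + 4 * (#s ^ 2 * N ^ 2 / T) := by ring
    _ ≤ N * #s * (9 * K * c ^ 2 * (6 + 1 / ε) ^ 2 * Y ^ η) + 4 * (#s ^ 2 * N ^ 2 / T) := by gcongr
    _ ≤ _ := by
      have e1 : 0 ≤ N * #s * Y ^ η := by positivity
      have e2 : 0 ≤ 9 * K * c ^ 2 * (6 + 1 / ε) ^ 2 * (#s ^ 2 * N ^ 2 / T) := by positivity
      linarith

theorem natCast_cpow_neg_one_sub {m : ℕ} (hm : 1 ≤ m) (t : ℝ) :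
    (m : ℂ) ^ (-(1 : ℂ) - Complex.I * (t : ℂ)) =
      (m : ℂ)⁻¹ * Complex.exp (-Complex.I * t * Real.log m) := by
  have hm0 : (m : ℂ) ≠ 0 := Nat.cast_ne_zero.2 (by omega)
  rw [sub_eq_add_neg, Complex.cpow_add _ _ hm0, Complex.cpow_neg_one, Complex.cpow_def_of_ne_zero hm0,
    ← Complex.natCast_log]
  congr 2
  ring

/-- Heath-Brown's sparse mean value estimate (in the case `|𝓜| ≤ T^{1/3}`, where the
third term can be deleted): for `M(s) = ∑_{m ∈ 𝓜} ε_m m^{-s}` with `𝓜 ⊆ [M, T]`,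
`|ε_m| ≤ 1`, and `A(s) = ∑_{n ∼ N} a_n n^{-s}` with real coefficients,
`∫_{-T}^T |M(1+it)|²|A(1+it)|² dt ≪_η ((|𝓜|/M)² + (NT)^η |𝓜| T/(M²N)) max_n |a_n|²`. -/
theorem stmt10 (η : ℝ) (hη : 0 < η) :
    ∃ C : ℝ, 0 < C ∧
      ∀ (T M : ℝ) (N : ℕ) (𝓜 : Finset ℕ) (ε : ℕ → ℂ) (a : ℕ → ℝ) (B : ℝ),
        1 ≤ M → M ≤ T → 2 ≤ N →
        (∀ m ∈ 𝓜, M ≤ (m : ℝ) ∧ (m : ℝ) ≤ T) →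
        ((𝓜.card : ℝ) ≤ T ^ ((1 : ℝ)/3)) →
        (∀ m, ‖ε m‖ ≤ 1) →
        (∀ n ∈ Finset.Ioc N (2 * N), |a n| ≤ B) →
        (∫ t in (-T)..T,
            ‖∑ m ∈ 𝓜, ε m * (m : ℂ) ^ (-(1 : ℂ) - Complex.I * (t : ℂ))‖ ^ 2 *
            ‖∑ n ∈ Finset.Ioc N (2 * N),
                (a n : ℂ) * (n : ℂ) ^ (-(1 : ℂ) - Complex.I * (t : ℂ))‖ ^ 2) ≤
          C * (((𝓜.card : ℝ) / M) ^ 2 +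
            ((N : ℝ) * T) ^ η * ((𝓜.card : ℝ) * T / (M ^ 2 * N))) * B ^ 2 := by
  obtain ⟨C₁, hC₁, hint⟩ := exists_integral_norm_sq_le_closePairs
  obtain ⟨C₂, hC₂, hcount⟩ := exists_closePairs_logMul_le η hη
  refine ⟨C₁ * C₂ * (2 * 2 ^ η + 4), by positivity, ?_⟩
  intro T M N 𝓜 ε a B hM hMT hN h𝓜 hcard hε ha
  have hT : 1 ≤ T := hM.trans hMT
  have hT0 : 0 < T := by linarith
  have hM0 : 0 < M := by linarith
  have hN0 : (0 : ℝ) < N := by positivity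
  have hm1 : ∀ m ∈ 𝓜, 1 ≤ m := fun m hm ↦ by exact_mod_cast hM.trans (h𝓜 m hm).1
  set c : ℕ × ℕ → ℂ := fun p ↦ ε p.1 * (p.1 : ℂ)⁻¹ * (a p.2 * (p.2 : ℂ)⁻¹)
  have hfun : ∀ t : ℝ, ‖∑ m ∈ 𝓜, ε m * (m : ℂ) ^ (-(1 : ℂ) - Complex.I * (t : ℂ))‖ ^ 2 *
      ‖∑ n ∈ Ioc N (2 * N), (a n : ℂ) * (n : ℂ) ^ (-(1 : ℂ) - Complex.I * (t : ℂ))‖ ^ 2 =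
      ‖∑ p ∈ 𝓜 ×ˢ Ioc N (2 * N), c p * Complex.exp (-Complex.I * t * logMul p)‖ ^ 2 := by
    intro t
    rw [← mul_pow, ← norm_mul, sum_mul_sum, sum_product]
    congr 2
    refine sum_congr rfl fun m hm ↦ sum_congr rfl fun n hn ↦ ?_
    rw [natCast_cpow_neg_one_sub (hm1 m hm),
      natCast_cpow_neg_one_sub (by have := (mem_Ioc.1 hn).1; omega)]
    simp only [c, logMul]
    rw [Complex.ofReal_add, mul_add, Complex.exp_add]
    ring
  simp_rw [hfun]
  have hc : ∀ p ∈ 𝓜 ×ˢ Ioc N (2 * N), ‖c p‖ ≤ B / (M * N) := by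
    rintro ⟨m, n⟩ hp
    obtain ⟨hm, hn⟩ := mem_product.1 hp
    have hB : 0 ≤ B := (abs_nonneg _).trans (ha n hn)
    have hnN : (N : ℝ) ≤ n := by exact_mod_cast (mem_Ioc.1 hn).1.le
    simp only [c, norm_mul, norm_inv, Complex.norm_natCast, Complex.norm_real, Real.norm_eq_abs]
    calc ‖ε m‖ * (m : ℝ)⁻¹ * (|a n| * (n : ℝ)⁻¹) ≤ 1 * M⁻¹ * (B * (N : ℝ)⁻¹) := by
          gcongr
          · exact hε m
          · exact (h𝓜 m hm).1
          · exact ha n hn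
      _ = _ := by field_simp
  have hcube : (#𝓜 : ℝ) ^ 3 ≤ T := by
    calc (#𝓜 : ℝ) ^ 3 ≤ (T ^ ((1 : ℝ) / 3)) ^ 3 := by gcongr
      _ = T := by rw [← Real.rpow_mul_natCast hT0.le]; norm_num
  have hsub : 𝓜 ×ˢ Ioc N (2 * N) ⊆ 𝓜 ×ˢ Icc 1 (2 * N) :=
    product_subset_product_right fun n hn ↦ by
      rw [mem_Ioc] at hn
      rw [mem_Icc]
      omega
  calc _ ≤ C₁ * T * (B / (M * N)) ^ 2 * closePairs (1 / T) (𝓜 ×ˢ Ioc N (2 * N)) logMul :=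
        hint _ _ _ _ _ hT0 hc
    _ ≤ C₁ * T * (B / (M * N)) ^ 2 * (C₂ * ((2 * N : ℕ) * #𝓜 * ((2 * N : ℕ) * T) ^ η +
          #𝓜 ^ 2 * (2 * N : ℕ) ^ 2 / T)) := by
        gcongr
        exact (closePairs_mono _ hsub _).trans (hcount T (2 * N) 𝓜 hT (by omega)
          (fun m hm ↦ ⟨hm1 m hm, (h𝓜 m hm).2⟩) hcube)
    _ = C₁ * C₂ * (4 * (#𝓜 / M) ^ 2 +
          2 * 2 ^ η * ((N * T) ^ η * (#𝓜 * T / (M ^ 2 * N)))) * B ^ 2 := by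
        push_cast
        rw [mul_assoc 2 (N : ℝ) T, Real.mul_rpow (by norm_num) (by positivity)]
        field_simp
        ring
    _ ≤ C₁ * C₂ * ((2 * 2 ^ η + 4) * (((#𝓜 : ℝ) / M) ^ 2 +
          (N * T) ^ η * (#𝓜 * T / (M ^ 2 * N)))) * B ^ 2 := by
        gcongr
        have e1 : (0 : ℝ) ≤ 2 * 2 ^ η * (#𝓜 / M) ^ 2 := by positivity
        have e2 : (0 : ℝ) ≤ (N * T) ^ η * (#𝓜 * T / (M ^ 2 * N)) := by positivity
        linarith
    _ = _ := by ring
end
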